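/- arXiv:1102.1739 — 5 statements merged into one kernel-verified Lean document; each statement's English description precedes it below -/
import Mathlib

section
/- Every densely-defined symmetric unbounded linear operator on a real Hilbert space admits a self-adjoint extension. -/
open scoped InnerProductSpace

namespace LinearPMap

section RCLike

variable {𝕜 E : Type*} [RCLike 𝕜] [NormedAddCommGroup E] [InnerProductSpace 𝕜 E]

theorem isFormalAdjoint_sSup {c : Set (E →ₗ.[𝕜] E)} (hc : IsChain (· ≤ ·) c)
    (hne : c.Nonempty) (hsymm : ∀ T ∈ c, T.IsFormalAdjoint T) :
    (LinearPMap.sSup c hc.directedOn).IsFormalAdjoint (LinearPMap.sSup c hc.directedOn) := by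
  rintro ⟨x, hx⟩ ⟨y, hy⟩
  obtain ⟨S, hS, hxS⟩ := (mem_domain_sSup_iff hne hc.directedOn).1 hx
  obtain ⟨T, hT, hyT⟩ := (mem_domain_sSup_iff hne hc.directedOn).1 hy
  obtain ⟨U, hU, hSU, hTU⟩ := hc.directedOn S hS T hT
  have hx' := LinearPMap.sSup_apply hc.directedOn hU ⟨x, hSU.1 hxS⟩
  have hy' := LinearPMap.sSup_apply hc.directedOn hU ⟨y, hTU.1 hyT⟩
  simpa [hx', hy'] using hsymm U hU ⟨x, hSU.1 hxS⟩ ⟨y, hTU.1 hyT⟩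

/-- Every symmetric operator extends to a maximal symmetric one. -/
theorem IsFormalAdjoint.exists_le_maximal {A : E →ₗ.[𝕜] E} (hA : A.IsFormalAdjoint A) :
    ∃ M, A ≤ M ∧ Maximal (fun T : E →ₗ.[𝕜] E ↦ T.IsFormalAdjoint T) M :=
  zorn_le_nonempty₀ {T : E →ₗ.[𝕜] E | T.IsFormalAdjoint T}
    (fun _ hcs hc T hT ↦ ⟨_, isFormalAdjoint_sSup hc ⟨T, hT⟩ hcs,
      fun _ hS ↦ LinearPMap.le_sSup hc.directedOn hS⟩) A hA

end RCLike

variable {H : Type*} [NormedAddCommGroup H] [InnerProductSpace ℝ H]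

/-- Over the reals, adjoining a vector `x` of the adjoint domain keeps an operator symmetric,
since `⟪T† x, x⟫ = ⟪x, T† x⟫` holds automatically. -/
theorem IsFormalAdjoint.supSpanSingleton {T : H →ₗ.[ℝ] H} (hT : T.IsFormalAdjoint T) {x w : H}
    (hx : x ∉ T.domain) (hw : ∀ y : T.domain, ⟪w, y⟫_ℝ = ⟪x, T y⟫_ℝ) :
    (T.supSpanSingleton x w hx).IsFormalAdjoint (T.supSpanSingleton x w hx) := by
  rintro ⟨u, hu⟩ ⟨v, hv⟩
  obtain ⟨a, ha, _, hb, rfl⟩ := Submodule.mem_sup.1 hu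
  obtain ⟨b, rfl⟩ := Submodule.mem_span_singleton.1 hb
  obtain ⟨c, hc, _, hd, rfl⟩ := Submodule.mem_sup.1 hv
  obtain ⟨d, rfl⟩ := Submodule.mem_span_singleton.1 hd
  have hac := hT ⟨a, ha⟩ ⟨c, hc⟩
  have hwa := hw ⟨a, ha⟩
  have hwc := hw ⟨c, hc⟩
  rw [supSpanSingleton_apply_mk _ _ _ _ _ ha, supSpanSingleton_apply_mk _ _ _ _ _ hc]
  simp only [RingHom.id_apply, inner_add_left, inner_add_right, real_inner_smul_left,
    real_inner_smul_right]
  rw [hac, hwc, real_inner_comm x (T ⟨a, ha⟩), real_inner_comm w a, real_inner_comm w x, hwa]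

/-- A densely defined maximal symmetric operator on a real Hilbert space is self-adjoint. -/
theorem adjoint_eq_of_maximal [CompleteSpace H] {M : H →ₗ.[ℝ] H}
    (hM : Maximal (fun T : H →ₗ.[ℝ] H ↦ T.IsFormalAdjoint T) M)
    (hd : Dense (M.domain : Set H)) : M.adjoint = M := by
  have hle : M ≤ M.adjoint := hM.prop.le_adjoint hd
  refine (eq_of_le_of_domain_eq hle (le_antisymm hle.1 fun x hx ↦ ?_)).symm
  by_contra hxM
  have hext : M ≤ M.supSpanSingleton x (M.adjoint ⟨x, hx⟩) hxM := LinearPMap.left_le_sup _ _ _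
  have hsymm := hM.prop.supSpanSingleton hxM fun y ↦ adjoint_isFormalAdjoint hd ⟨x, hx⟩ y
  refine hxM ((hM.le_of_ge hsymm hext).1 ?_)
  rw [domain_supSpanSingleton]
  exact Submodule.mem_sup_right (Submodule.mem_span_singleton_self x)

end LinearPMap

/-- Every densely-defined symmetric unbounded linear operator on a real Hilbert
space admits a self-adjoint extension. -/
theorem stmt_0 {H : Type*} [NormedAddCommGroup H] [InnerProductSpace ℝ H]
    [CompleteSpace H] (A : H →ₗ.[ℝ] H) (hdense : Dense (A.domain : Set H))
    (hsymm : ∀ x y : A.domain, ⟪A x, (y : H)⟫_ℝ = ⟪(x : H), A y⟫_ℝ) :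
    ∃ M : H →ₗ.[ℝ] H, A ≤ M ∧ M.adjoint = M := by
  obtain ⟨M, hAM, hM⟩ := LinearPMap.IsFormalAdjoint.exists_le_maximal (A := A) hsymm
  exact ⟨M, hAM, LinearPMap.adjoint_eq_of_maximal hM (hdense.mono hAM.1)⟩
end

section
/- A maximal symmetric densely-defined operator on a real Hilbert space is self-adjoint: if M is densely defined and symmetric, and every symmetric operator T with M ⊆ T satisfies T = M, then M* = M. -/
open scoped InnerProductSpace

/-- Extending a symmetric operator by one value of its adjoint gives a symmetric operator. -/
theorem LinearPMap.IsFormalAdjoint.supSpanSingleton_adjoint {H : Type*} [NormedAddCommGroup H]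
    [InnerProductSpace ℝ H] [CompleteSpace H] {M : H →ₗ.[ℝ] H}
    (hdense : Dense (M.domain : Set H)) (hsymm : M.IsFormalAdjoint M)
    (y : M.adjoint.domain) (hy : (y : H) ∉ M.domain) :
    (M.supSpanSingleton y (M.adjoint y) hy).IsFormalAdjoint
      (M.supSpanSingleton y (M.adjoint y) hy) := by
  rintro ⟨u, hu⟩ ⟨v, hv⟩
  obtain ⟨a, ha, b, hb, rfl⟩ := Submodule.mem_sup.mp hu
  obtain ⟨c, rfl⟩ := Submodule.mem_span_singleton.mp hb
  obtain ⟨a', ha', b', hb', rfl⟩ := Submodule.mem_sup.mp hv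
  obtain ⟨c', rfl⟩ := Submodule.mem_span_singleton.mp hb'
  have hadj := LinearPMap.adjoint_isFormalAdjoint hdense
  have h₁ := hsymm ⟨a, ha⟩ ⟨a', ha'⟩
  have h₂ := hadj y ⟨a', ha'⟩
  have h₃ := hadj.symm ⟨a, ha⟩ y
  rw [LinearPMap.supSpanSingleton_apply_mk M _ _ hy a ha,
    LinearPMap.supSpanSingleton_apply_mk M _ _ hy a' ha']
  simp only [RingHom.id_apply, inner_add_left, inner_add_right, real_inner_smul_left,
    real_inner_smul_right, h₁, h₂, h₃, real_inner_comm (y : H) (M.adjoint y)]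

/-- A maximal symmetric densely-defined operator on a real Hilbert space is
self-adjoint. -/
theorem stmt_4 {H : Type*} [NormedAddCommGroup H] [InnerProductSpace ℝ H]
    [CompleteSpace H] (M : H →ₗ.[ℝ] H) (hdense : Dense (M.domain : Set H))
    (hsymm : ∀ x y : M.domain, ⟪M x, (y : H)⟫_ℝ = ⟪(x : H), M y⟫_ℝ)
    (hmax : ∀ T : H →ₗ.[ℝ] H,
      (∀ x y : T.domain, ⟪T x, (y : H)⟫_ℝ = ⟪(x : H), T y⟫_ℝ) → M ≤ T →
        T = M) :
    M.adjoint = M := by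
  have hM : M.IsFormalAdjoint M := hsymm
  have hle : M ≤ M.adjoint := hM.le_adjoint hdense
  refine (LinearPMap.eq_of_le_of_domain_eq hle (le_antisymm hle.1 fun y hy => ?_)).symm
  by_contra hyM
  have hT := hmax _ (hM.supSpanSingleton_adjoint hdense ⟨y, hy⟩ hyM)
    (LinearPMap.left_le_sup _ _ _)
  apply hyM
  rw [← hT]
  exact Submodule.mem_sup_right (Submodule.mem_span_singleton_self y)
end

section
/- Let M be a densely-defined symmetric operator on a real Hilbert space and let p ∈ D(M*) with p ∉ D(M). Then the linear operator T defined on the subspace D(M) + span{p} by T(x + a·p) = M x + a·(M* p) for x ∈ D(M) and a ∈ ℝ is a symmetric extension of M that properly extends M (its domain strictly contains D(M)). -/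
open scoped InnerProductSpace

/-- If `M` is densely-defined symmetric and `p ∈ D(M*) \ D(M)`, then the map
`T(x + a • p) = M x + a • (M* p)` on `D(M) ⊔ span {p}` is a symmetric proper
extension of `M`. -/
theorem stmt_5 {H : Type*} [NormedAddCommGroup H] [InnerProductSpace ℝ H]
    [CompleteSpace H] (M : H →ₗ.[ℝ] H) (hdense : Dense (M.domain : Set H))
    (hsymm : ∀ x y : M.domain, ⟪M x, (y : H)⟫_ℝ = ⟪(x : H), M y⟫_ℝ)
    (p : M.adjoint.domain) (hp : (p : H) ∉ M.domain) :
    ∃ T : H →ₗ.[ℝ] H,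
      T.domain = M.domain ⊔ Submodule.span ℝ {(p : H)} ∧
      M ≤ T ∧ M.domain < T.domain ∧
      (∀ (x : M.domain) (a : ℝ) (h : (x : H) + a • (p : H) ∈ T.domain),
        T ⟨(x : H) + a • (p : H), h⟩ = M x + a • M.adjoint p) ∧
      (∀ u v : T.domain, ⟪T u, (v : H)⟫_ℝ = ⟪(u : H), T v⟫_ℝ) := by
  have hadj := LinearPMap.adjoint_isFormalAdjoint hdense p
  have happly (x : M.domain) (a : ℝ)
      (h : (x : H) + a • (p : H) ∈ (M.supSpanSingleton (p : H) (M.adjoint p) hp).domain) :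
      M.supSpanSingleton (p : H) (M.adjoint p) hp ⟨(x : H) + a • (p : H), h⟩ =
        M x + a • M.adjoint p :=
    M.supSpanSingleton_apply_mk (p : H) (M.adjoint p) hp x x.2 a
  refine ⟨M.supSpanSingleton (p : H) (M.adjoint p) hp, rfl, LinearPMap.left_le_sup _ _ _,
    ?_, happly, ?_⟩
  · exact SetLike.lt_iff_le_and_exists.2 ⟨le_sup_left, (p : H),
      Submodule.mem_sup_right (Submodule.mem_span_singleton_self _), hp⟩
  · rintro ⟨u, hu⟩ ⟨v, hv⟩
    obtain ⟨x, hx, _, hp₁, rfl⟩ := Submodule.mem_sup.1 hu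
    obtain ⟨a, rfl⟩ := Submodule.mem_span_singleton.1 hp₁
    obtain ⟨y, hy, _, hp₂, rfl⟩ := Submodule.mem_sup.1 hv
    obtain ⟨b, rfl⟩ := Submodule.mem_span_singleton.1 hp₂
    rw [happly ⟨x, hx⟩ a hu, happly ⟨y, hy⟩ b hv]
    have hxy := hsymm ⟨x, hx⟩ ⟨y, hy⟩
    have hpx := hadj ⟨x, hx⟩
    have hpy := hadj ⟨y, hy⟩
    rw [real_inner_comm x, real_inner_comm (M ⟨x, hx⟩)] at hpx
    simp only [inner_add_left, inner_add_right, real_inner_smul_left, real_inner_smul_right]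
    rw [hxy, hpy, hpx, real_inner_comm (M.adjoint p) (p : H)]
end

section
/- Let A be a densely-defined symmetric operator on a real Hilbert space whose range is dense and for which there exists c > 0 with ‖A x‖ ≥ c·‖x‖ for all x ∈ D(A) (i.e. A is injective with continuous inverse). Then the closure Ā of A is self-adjoint, and any self-adjoint extension of A equals Ā; in particular A has exactly one self-adjoint extension. -/
open scoped InnerProductSpace

namespace LinearPMap

variable {H : Type*} [NormedAddCommGroup H] [InnerProductSpace ℝ H] [CompleteSpace H]

theorem adjoint_anti {S T : H →ₗ.[ℝ] H} (hS : Dense (S.domain : Set H)) (h : S ≤ T) :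
    T.adjoint ≤ S.adjoint := by
  refine IsFormalAdjoint.le_adjoint hS fun x y => ?_
  have hT : Dense (T.domain : Set H) := hS.mono h.1
  rw [h.2 (x := x) (y := ⟨x, h.1 x.2⟩) rfl]
  exact (adjoint_isFormalAdjoint hT).symm ⟨x, h.1 x.2⟩ y

theorem isClosable_of_isFormalAdjoint_self {A : H →ₗ.[ℝ] H} (hA : Dense (A.domain : Set H))
    (hsymm : A.IsFormalAdjoint A) : A.IsClosable :=
  (adjoint_isClosed hA).isClosable.leIsClosable (hsymm.le_adjoint hA)

theorem adjoint_closure {A : H →ₗ.[ℝ] H} (hA : Dense (A.domain : Set H)) (hc : A.IsClosable) :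
    A.closure.adjoint = A.adjoint := by
  refine le_antisymm (adjoint_anti hA A.le_closure) ?_
  refine IsFormalAdjoint.le_adjoint (hA.mono A.le_closure.1) fun x y => ?_
  have hmem : ((x : H), A.closure x) ∈ _root_.closure (A.graph : Set (H × H)) := by
    rw [← Submodule.topologicalClosure_coe, hc.graph_closure_eq_closure_graph]
    exact A.closure.mem_graph x
  have hcl : _root_.IsClosed {p : H × H | ⟪p.2, (y : H)⟫_ℝ = ⟪p.1, A.adjoint y⟫_ℝ} :=
    isClosed_eq (by fun_prop) (by fun_prop)
  refine closure_minimal (fun p hp => ?_) hcl hmem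
  obtain ⟨z, rfl⟩ := A.mem_graph_iff'.1 hp
  exact (adjoint_isFormalAdjoint hA).symm z y

/-- The adjoint of a symmetric operator that is bounded below and has dense range is contained in
its closure. -/
theorem adjoint_le_closure {A : H →ₗ.[ℝ] H} (hA : Dense (A.domain : Set H))
    (hsymm : A.IsFormalAdjoint A) (hrange : Dense (Set.range fun x : A.domain => A x))
    {c : ℝ} (hc : 0 < c) (hbelow : ∀ x : A.domain, c * ‖(x : H)‖ ≤ ‖A x‖) :
    A.adjoint ≤ A.closure := by
  refine le_of_le_graph fun p hp => ?_
  rw [← (isClosable_of_isFormalAdjoint_self hA hsymm).graph_closure_eq_closure_graph,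
    ← SetLike.mem_coe, Submodule.topologicalClosure_coe]
  obtain ⟨z, rfl⟩ := A.adjoint.mem_graph_iff'.1 hp
  have key (x : A.domain) : c * ‖(x : H) - z‖ ≤ ‖A x - A.adjoint z‖ := by
    have hcl : _root_.IsClosed {v : H | c * ⟪(x : H) - z, v⟫_ℝ ≤ ‖A x - A.adjoint z‖ * ‖v‖} :=
      isClosed_le (by fun_prop) (by fun_prop)
    have hv : c * ⟪(x : H) - z, (x : H) - z⟫_ℝ ≤ ‖A x - A.adjoint z‖ * ‖(x : H) - z‖ := by
      refine closure_minimal ?_ hcl (hrange ((x : H) - z))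
      rintro _ ⟨y, rfl⟩
      have h1 : ⟪(x : H) - z, A y⟫_ℝ = ⟪A x - A.adjoint z, (y : H)⟫_ℝ := by
        rw [inner_sub_left, inner_sub_left, hsymm x y, adjoint_isFormalAdjoint hA z y]
      have h2 := real_inner_le_norm (A x - A.adjoint z) (y : H)
      have h3 := mul_le_mul_of_nonneg_left (hbelow y) (norm_nonneg (A x - A.adjoint z))
      have h4 := mul_le_mul_of_nonneg_left h2 hc.le
      change c * ⟪(x : H) - z, A y⟫_ℝ ≤ ‖A x - A.adjoint z‖ * ‖A y‖
      rw [h1]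
      linarith
    rw [real_inner_self_eq_norm_mul_norm, ← mul_assoc] at hv
    rcases (norm_nonneg ((x : H) - z)).eq_or_lt with h0 | h0
    · rw [← h0, mul_zero]
      exact norm_nonneg _
    · exact le_of_mul_le_mul_right hv h0
  refine Metric.mem_closure_iff.2 fun ε hε => ?_
  obtain ⟨_, ⟨x, rfl⟩, hx⟩ :=
    Metric.mem_closure_iff.1 (hrange (A.adjoint z)) (min ε (c * ε)) (lt_min hε (mul_pos hc hε))
  refine ⟨(x, A x), A.mem_graph x, ?_⟩
  rw [Prod.dist_eq]
  refine max_lt ?_ (hx.trans_le (min_le_left _ _))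
  have hlt : ‖A x - A.adjoint z‖ < c * ε := by
    rw [← dist_eq_norm, dist_comm]
    exact hx.trans_le (min_le_right _ _)
  rw [dist_comm, dist_eq_norm]
  exact lt_of_mul_lt_mul_left ((key x).trans_lt hlt) hc.le

end LinearPMap

/-- If `A` is densely-defined, symmetric, has dense range, and is bounded below
(`‖A x‖ ≥ c ‖x‖` for some `c > 0`), then its closure is the unique self-adjoint
extension of `A`. -/
theorem stmt_6 {H : Type*} [NormedAddCommGroup H] [InnerProductSpace ℝ H]
    [CompleteSpace H] (A : H →ₗ.[ℝ] H) (hdense : Dense (A.domain : Set H))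
    (hsymm : ∀ x y : A.domain, ⟪A x, (y : H)⟫_ℝ = ⟪(x : H), A y⟫_ℝ)
    (hrange : Dense (Set.range fun x : A.domain => A x))
    (hbelow : ∃ c > 0, ∀ x : A.domain, c * ‖(x : H)‖ ≤ ‖A x‖) :
    A.closure.adjoint = A.closure ∧
      ∀ M : H →ₗ.[ℝ] H, M.adjoint = M → A ≤ M → M = A.closure := by
  obtain ⟨c, hc, hbelow⟩ := hbelow
  have hformal : A.IsFormalAdjoint A := hsymm
  have hclosable := LinearPMap.isClosable_of_isFormalAdjoint_self hdense hformal
  have hle : A.adjoint ≤ A.closure :=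
    LinearPMap.adjoint_le_closure hdense hformal hrange hc hbelow
  have hge : A.closure ≤ A.adjoint := by
    refine LinearPMap.le_of_le_graph ?_
    rw [← hclosable.graph_closure_eq_closure_graph]
    exact Submodule.topologicalClosure_minimal _
      (LinearPMap.le_graph_of_le (hformal.le_adjoint hdense))
      (LinearPMap.adjoint_isClosed hdense)
  have hself : A.closure.adjoint = A.closure :=
    (LinearPMap.adjoint_closure hdense hclosable).trans (le_antisymm hle hge)
  refine ⟨hself, fun M hM hAM => ?_⟩
  have hMle : M ≤ A.closure := hM ▸ (LinearPMap.adjoint_anti hdense hAM).trans hle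
  refine le_antisymm hMle ?_
  have h := LinearPMap.adjoint_anti (hdense.mono hAM.1) hMle
  rwa [hself, hM] at h
end

section
/- Let A be a densely-defined symmetric operator on a real Hilbert space whose range is dense and for which there exists c > 0 with ‖A x‖ ≥ c·‖x‖ for all x ∈ D(A). Then the closure Ā of A is injective and surjective onto H, and its inverse is a continuous self-adjoint operator defined on all of H. -/
open scoped InnerProductSpace

namespace LinearPMap

variable {H : Type*} [NormedAddCommGroup H]

section Symmetric

variable [InnerProductSpace ℝ H]

/-- A densely-defined symmetric operator is closable. -/
theorem isClosable_of_dense_of_symmetric [CompleteSpace H] {A : H →ₗ.[ℝ] H}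
    (hdense : Dense (A.domain : Set H))
    (hsymm : ∀ x y : A.domain, ⟪A x, (y : H)⟫_ℝ = ⟪(x : H), A y⟫_ℝ) : A.IsClosable :=
  isClosable_iff_exists_closed_extension.2
    ⟨A.adjoint, adjoint_isClosed hdense, IsFormalAdjoint.le_adjoint hdense hsymm⟩

/-- The closure of a closable symmetric operator is symmetric. -/
theorem IsClosable.inner_closure_eq {A : H →ₗ.[ℝ] H} (hA : A.IsClosable)
    (hsymm : ∀ x y : A.domain, ⟪A x, (y : H)⟫_ℝ = ⟪(x : H), A y⟫_ℝ) (x y : A.closure.domain) :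
    ⟪A.closure x, (y : H)⟫_ℝ = ⟪(x : H), A.closure y⟫_ℝ := by
  have hmem (z : A.closure.domain) :
      ((z : H), A.closure z) ∈ _root_.closure (A.graph : Set (H × H)) := by
    rw [← Submodule.topologicalClosure_coe, hA.graph_closure_eq_closure_graph]
    exact A.closure.mem_graph z
  have hclosed : _root_.IsClosed
      {r : (H × H) × (H × H) | ⟪r.1.2, r.2.1⟫_ℝ = ⟪r.1.1, r.2.2⟫_ℝ} :=
    isClosed_eq (by fun_prop) (by fun_prop)
  have hsub : (A.graph : Set (H × H)) ×ˢ (A.graph : Set (H × H)) ⊆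
      {r : (H × H) × (H × H) | ⟪r.1.2, r.2.1⟫_ℝ = ⟪r.1.1, r.2.2⟫_ℝ} := by
    rintro ⟨p, q⟩ ⟨hp, hq⟩
    obtain ⟨a, ha, ha'⟩ := A.mem_graph_iff.1 hp
    obtain ⟨b, hb, hb'⟩ := A.mem_graph_iff.1 hq
    have h := hsymm a b
    rwa [ha, ha', hb, hb'] at h
  have h := closure_minimal hsub hclosed
  rw [closure_prod_eq] at h
  exact h (Set.mk_mem_prod (hmem x) (hmem y))

end Symmetric

section BoundedBelow

variable [NormedSpace ℝ H]

/-- The closure of a closable operator is bounded below by the same constant. -/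
theorem IsClosable.le_norm_closure {A : H →ₗ.[ℝ] H} (hA : A.IsClosable) {c : ℝ}
    (hbelow : ∀ x : A.domain, c * ‖(x : H)‖ ≤ ‖A x‖) (x : A.closure.domain) :
    c * ‖(x : H)‖ ≤ ‖A.closure x‖ := by
  have hclosed : _root_.IsClosed {p : H × H | c * ‖p.1‖ ≤ ‖p.2‖} :=
    isClosed_le (by fun_prop) (by fun_prop)
  have hsub : (A.graph : Set (H × H)) ⊆ {p : H × H | c * ‖p.1‖ ≤ ‖p.2‖} := by
    intro p hp
    obtain ⟨a, ha, ha'⟩ := A.mem_graph_iff.1 hp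
    simpa [← ha, ← ha'] using hbelow a
  have hmem : ((x : H), A.closure x) ∈ _root_.closure (A.graph : Set (H × H)) := by
    rw [← Submodule.topologicalClosure_coe, hA.graph_closure_eq_closure_graph]
    exact A.closure.mem_graph x
  exact closure_minimal hsub hclosed hmem

/-- An operator that is bounded below by a positive constant is injective. -/
theorem injective_of_le_norm {B : H →ₗ.[ℝ] H} {c : ℝ} (hc : 0 < c)
    (hbelow : ∀ x : B.domain, c * ‖(x : H)‖ ≤ ‖B x‖) : Function.Injective B := by
  refine (injective_iff_map_eq_zero B.toFun).2 fun x hx => ?_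
  have h := hbelow x
  rw [show B x = 0 from hx, norm_zero] at h
  exact Subtype.ext (norm_le_zero_iff.1 (nonpos_of_mul_nonpos_right h hc))

/-- A closed operator that is bounded below has closed range. -/
theorem IsClosed.isClosed_range_of_le_norm [CompleteSpace H] {B : H →ₗ.[ℝ] H} (hB : B.IsClosed)
    {c : ℝ} (hc : 0 < c) (hbelow : ∀ x : B.domain, c * ‖(x : H)‖ ≤ ‖B x‖) :
    _root_.IsClosed (Set.range B) := by
  have : CompleteSpace B.graph := _root_.IsClosed.completeSpace_coe (hs := hB)
  let f : B.graph →L[ℝ] H := (ContinuousLinearMap.snd ℝ H H).comp B.graph.subtypeL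
  have hf : AntilipschitzWith (max 1 c⁻¹).toNNReal f := by
    refine AddMonoidHomClass.antilipschitz_of_bound f fun p => ?_
    obtain ⟨a, ha, ha'⟩ := B.mem_graph_iff.1 p.2
    rw [Real.coe_toNNReal _ (zero_le_one.trans (le_max_left _ _))]
    change max ‖p.1.1‖ ‖p.1.2‖ ≤ max 1 c⁻¹ * ‖p.1.2‖
    have h : ‖p.1.1‖ ≤ c⁻¹ * ‖p.1.2‖ := by
      rw [← ha, ← ha']
      exact (le_inv_mul_iff₀ hc).2 (hbelow a)
    refine max_le (h.trans (by gcongr; exact le_max_right _ _)) ?_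
    exact le_mul_of_one_le_left (norm_nonneg _) (le_max_left _ _)
  convert hf.isClosed_range f.uniformContinuous using 1
  ext y
  rw [mem_range_iff]
  constructor
  · rintro ⟨x, hx⟩
    exact ⟨⟨(x, y), hx⟩, rfl⟩
  · rintro ⟨⟨⟨x, z⟩, hx⟩, rfl⟩
    exact ⟨x, hx⟩

end BoundedBelow

end LinearPMap

/-- If `A` is densely-defined, symmetric, has dense range, and is bounded below,
then its closure is a bijection from its domain onto `H`, with continuous
self-adjoint inverse defined on all of `H`. -/
theorem stmt_7 {H : Type*} [NormedAddCommGroup H] [InnerProductSpace ℝ H]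
    [CompleteSpace H] (A : H →ₗ.[ℝ] H) (hdense : Dense (A.domain : Set H))
    (hsymm : ∀ x y : A.domain, ⟪A x, (y : H)⟫_ℝ = ⟪(x : H), A y⟫_ℝ)
    (hrange : Dense (Set.range fun x : A.domain => A x))
    (hbelow : ∃ c > 0, ∀ x : A.domain, c * ‖(x : H)‖ ≤ ‖A x‖) :
    Function.Injective (fun x : A.closure.domain => A.closure x) ∧
    Function.Surjective (fun x : A.closure.domain => A.closure x) ∧
    ∃ S : H →L[ℝ] H, (∀ x y : H, ⟪S x, y⟫_ℝ = ⟪x, S y⟫_ℝ) ∧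
      (∀ x : A.closure.domain, S (A.closure x) = x) ∧
      (∀ y : H, ∃ x : A.closure.domain, A.closure x = y ∧ (x : H) = S y) := by
  obtain ⟨c, hc, hbelow⟩ := hbelow
  have hA := LinearPMap.isClosable_of_dense_of_symmetric hdense hsymm
  have hbelow' := hA.le_norm_closure hbelow
  have hsymm' := hA.inner_closure_eq hsymm
  have hinj : Function.Injective A.closure.toFun := LinearPMap.injective_of_le_norm hc hbelow'
  have hsurj : Function.Surjective A.closure.toFun := by
    have hsub : (Set.range fun x : A.domain => A x) ⊆ Set.range A.closure := by
      rintro _ ⟨x, rfl⟩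
      exact ⟨⟨x, A.le_closure.1 x.2⟩, (A.le_closure.2 rfl).symm⟩
    have hclosed := hA.closure_isClosed.isClosed_range_of_le_norm hc hbelow'
    exact Set.range_eq_univ.1 (hclosed.closure_eq ▸ (hrange.mono hsub).closure_eq)
  let e := LinearEquiv.ofBijective A.closure.toFun ⟨hinj, hsurj⟩
  have he (y : H) : A.closure (e.symm y) = y := e.apply_symm_apply y
  let S : H →L[ℝ] H := (A.closure.domain.subtype ∘ₗ e.symm.toLinearMap).mkContinuous c⁻¹
    fun y => (le_inv_mul_iff₀ hc).2 ((hbelow' (e.symm y)).trans_eq (by rw [he]))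
  refine ⟨hinj, hsurj, S, fun x y => ?_, fun x => ?_, fun y => ⟨e.symm y, he y, rfl⟩⟩
  · have h := hsymm' (e.symm x) (e.symm y)
    rw [he, he] at h
    exact h.symm
  · exact congrArg Subtype.val (e.symm_apply_apply x)
end
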